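/- Let X be a metric space with metric completion X̃ (X regarded as a dense subspace of X̃), let L ≥ 0, and let 𝒥 be a collection of subsets of X such that: (a) every member of 𝒥 is a nonempty closed totally bounded subset of X; (b) {x} ∈ 𝒥 for every x ∈ X; and (c) every nonempty closed subset of a member of 𝒥 again belongs to 𝒥. Let A, B ∈ 𝒥 and let γ : [0,1] → 𝒥 satisfy γ(0) = A, γ(1) = B, and d_H(γ(s), γ(t)) ≤ L·|s−t| for all s,t ∈ [0,1]. Then there exists a nonempty family Γ of L-Lipschitz maps c : [0,1] → X̃ such that: (i) {c(0) : c ∈ Γ} is a dense subset of Ã and {c(1) : c ∈ Γ} is a dense subset of B̃ (the endpoint relation {(c(0), c(1)) : c ∈ Γ} ⊆ Ã × B̃ is densely complete); and (ii) for every t ∈ [0,1], the closure in X̃ of {c(t) : c ∈ Γ} equals the closure of γ(t) in X̃, so in particular γ(t) = cl_{X̃}{c(t) : c ∈ Γ} ∩ X. -/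

import Mathlib

open unitInterval

theorem finite_selection_aux {Y : Type*} [MetricSpace Y] (L : ℝ)
    (K : unitInterval → Set Y) (hne : ∀ t, (K t).Nonempty)
    (hK : ∀ s t, ∀ p ∈ K s, ∃ q ∈ K t, dist p q ≤ L * dist s t) (F : Finset unitInterval) :
    ∀ t₀ ∈ F, ∀ p ∈ K t₀, ∃ c : unitInterval → Y, (∀ t, c t ∈ K t) ∧ c t₀ = p ∧
      ∀ s ∈ F, ∀ t ∈ F, dist (c s) (c t) ≤ L * dist s t := by
  classical
  induction F using Finset.induction_on_max with
  | empty => simp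
  | insert a F ha ih =>
    intro t₀ ht₀ p hp
    rcases F.eq_empty_or_nonempty with rfl | hF
    · have h : t₀ = a := by simpa using ht₀
      subst h
      choose g hg using hne
      refine ⟨Function.update g t₀ p, ?_, by simp, ?_⟩
      · intro t
        by_cases h : t = t₀
        · subst h; simpa using hp
        · simpa [Function.update_of_ne h] using hg t
      · simp
    · set m := F.max' hF with hm
      have hmF : m ∈ F := F.max'_mem hF
      have key : ∃ c : unitInterval → Y, ∃ r ∈ K a, (∀ t, c t ∈ K t) ∧
          (t₀ = a → r = p) ∧ (t₀ ≠ a → c t₀ = p) ∧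
          (∀ s ∈ F, ∀ t ∈ F, dist (c s) (c t) ≤ L * dist s t) ∧
          dist (c m) r ≤ L * dist m a := by
        by_cases h : t₀ = a
        · subst h
          obtain ⟨q, hq, hd⟩ := hK t₀ m p hp
          obtain ⟨c, h1, h2, h3⟩ := ih m hmF q hq
          refine ⟨c, p, hp, h1, fun _ => rfl, fun h => absurd rfl h, h3, ?_⟩
          rw [h2, dist_comm q, dist_comm m]; exact hd
        · have ht : t₀ ∈ F := (Finset.mem_insert.1 ht₀).resolve_left h
          obtain ⟨c, h1, h2, h3⟩ := ih t₀ ht p hp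
          obtain ⟨r, hr, hd⟩ := hK m a (c m) (h1 m)
          exact ⟨c, r, hr, h1, fun h' => absurd h' h, fun _ => h2, h3, hd⟩
      obtain ⟨c, r, hr, h1, h2, h3, h4, h5⟩ := key
      have h6 : ∀ s ∈ F, dist (c s) r ≤ L * dist s a := by
        intro s hs
        have hsm : s ≤ m := F.le_max' s hs
        have hma : m ≤ a := (ha m hmF).le
        have e : dist s a = dist s m + dist m a := by
          have e1 : (s : ℝ) ≤ m := hsm
          have e2 : (m : ℝ) ≤ a := hma
          rw [Subtype.dist_eq, Subtype.dist_eq, Subtype.dist_eq, Real.dist_eq, Real.dist_eq,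
            Real.dist_eq, abs_of_nonpos (by linarith), abs_of_nonpos (by linarith),
            abs_of_nonpos (by linarith)]
          ring
        rw [e, mul_add]
        exact (dist_triangle _ (c m) _).trans (add_le_add (h4 s hs m hmF) h5)
      have hFa : ∀ s ∈ F, s ≠ a := fun s hs => (ha s hs).ne
      refine ⟨Function.update c a r, ?_, ?_, ?_⟩
      · intro t
        by_cases h : t = a
        · subst h; simpa using hr
        · simpa [Function.update_of_ne h] using h1 t
      · by_cases h : t₀ = a
        · subst h; simpa using h2 rfl
        · simpa [Function.update_of_ne h] using h3 h
      · intro s hs t ht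
        rcases Finset.mem_insert.1 hs with rfl | hs2
        · rcases Finset.mem_insert.1 ht with rfl | ht2
          · simp
          · rw [Function.update_self, Function.update_of_ne (hFa t ht2), dist_comm, dist_comm s]
            exact h6 t ht2
        · rcases Finset.mem_insert.1 ht with rfl | ht2
          · rw [Function.update_self, Function.update_of_ne (hFa s hs2)]
            exact h6 s hs2
          · rw [Function.update_of_ne (hFa s hs2), Function.update_of_ne (hFa t ht2)]
            exact h4 s hs2 t ht2

theorem selection_aux {Y : Type*} [MetricSpace Y] (L : ℝ)
    (K : unitInterval → Set Y) (hne : ∀ t, (K t).Nonempty) (hc : ∀ t, IsCompact (K t))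
    (hK : ∀ s t, ∀ p ∈ K s, ∃ q ∈ K t, dist p q ≤ L * dist s t)
    (t₀ : unitInterval) (p : Y) (hp : p ∈ K t₀) :
    ∃ c : unitInterval → Y, (∀ t, c t ∈ K t) ∧ c t₀ = p ∧
      ∀ s t, dist (c s) (c t) ≤ L * dist s t := by
  classical
  let S : Finset unitInterval → Set (unitInterval → Y) := fun F =>
    Set.univ.pi K ∩ {c | c t₀ = p ∧ ∀ s ∈ F, ∀ t ∈ F, dist (c s) (c t) ≤ L * dist s t}
  have hP : IsCompact (Set.univ.pi K) := isCompact_univ_pi hc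
  have hcl : ∀ F : Finset unitInterval, IsClosed {c : unitInterval → Y | c t₀ = p ∧
      ∀ s ∈ F, ∀ t ∈ F, dist (c s) (c t) ≤ L * dist s t} := by
    intro F
    have e : {c : unitInterval → Y | c t₀ = p ∧
      ∀ s ∈ F, ∀ t ∈ F, dist (c s) (c t) ≤ L * dist s t} = {c | c t₀ = p} ∩
        ⋂ s ∈ F, ⋂ t ∈ F, {c | dist (c s) (c t) ≤ L * dist s t} := by
      ext c; simp only [Set.mem_setOf_eq, Set.mem_inter_iff, Set.mem_iInter]
    rw [e]
    refine (isClosed_eq (continuous_apply t₀) continuous_const).inter ?_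
    refine isClosed_biInter fun s _ => isClosed_biInter fun t _ => ?_
    exact isClosed_le ((continuous_apply s).dist (continuous_apply t)) continuous_const
  have hne' : (⋂ F, S F).Nonempty := by
    apply IsCompact.nonempty_iInter_of_directed_nonempty_isCompact_isClosed
    · intro F G
      refine ⟨F ∪ G, ?_, ?_⟩
      · rintro c ⟨h1, h2, h3⟩
        exact ⟨h1, h2, fun s hs t ht => h3 s (Finset.mem_union_left _ hs) t
          (Finset.mem_union_left _ ht)⟩
      · rintro c ⟨h1, h2, h3⟩
        exact ⟨h1, h2, fun s hs t ht => h3 s (Finset.mem_union_right _ hs) t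
          (Finset.mem_union_right _ ht)⟩
    · intro F
      obtain ⟨c, h1, h2, h3⟩ := finite_selection_aux L K hne hK (insert t₀ F) t₀
        (Finset.mem_insert_self _ _) p hp
      exact ⟨c, fun t _ => h1 t, h2, fun s hs t ht => h3 s (Finset.mem_insert_of_mem hs) t
        (Finset.mem_insert_of_mem ht)⟩
    · exact fun F => hP.inter_right (hcl F)
    · exact fun F => hP.isClosed.inter (hcl F)
  obtain ⟨c, hcS⟩ := hne'
  rw [Set.mem_iInter] at hcS
  refine ⟨c, fun t => (hcS ∅).1 t trivial, (hcS ∅).2.1, fun s t => ?_⟩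
  exact (hcS {s, t}).2.2 s (by simp) t (by simp)

/-- Representation of Lipschitz paths in `PCl(X)`: let `𝒥` be a collection of nonempty closed
totally bounded subsets of `X` containing all singletons and stable under passing to nonempty
closed subsets. If `γ : [0,1] → 𝒥` is an `L`-Lipschitz path (for the Hausdorff distance) from
`A` to `B`, then there is a nonempty family `Γ` of `L`-Lipschitz maps `[0,1] → X̃` into the
completion of `X` whose endpoint sets are dense in the closures `Ã`, `B̃`, and such that for each
`t`, the closure in `X̃` of `{c(t) : c ∈ Γ}` equals the closure of `γ(t)` in `X̃`; in particular
`γ(t) = cl_{X̃}{c(t) : c ∈ Γ} ∩ X`. -/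
theorem representation_of_lipschitz_paths_PCl {X : Type*} [MetricSpace X]
    (L : ℝ) (hL : 0 ≤ L) (𝒥 : Set (Set X))
    (hJ : ∀ C ∈ 𝒥, C.Nonempty ∧ IsClosed C ∧ TotallyBounded C)
    (hJs : ∀ x : X, {x} ∈ 𝒥)
    (hJst : ∀ C ∈ 𝒥, ∀ D : Set X, D ⊆ C → D.Nonempty → IsClosed D → D ∈ 𝒥)
    (A B : Set X) (hA : A ∈ 𝒥) (hB : B ∈ 𝒥)
    (γ : unitInterval → Set X) (hγJ : ∀ t : unitInterval, γ t ∈ 𝒥)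
    (hγ0 : γ 0 = A) (hγ1 : γ 1 = B)
    (hγL : ∀ s t : unitInterval, Metric.hausdorffDist (γ s) (γ t) ≤ L * dist s t) :
    ∃ Γ : Set (unitInterval → UniformSpace.Completion X), Γ.Nonempty ∧
      (∀ c ∈ Γ, ∀ s t : unitInterval, dist (c s) (c t) ≤ L * dist s t) ∧
      closure {p | ∃ c ∈ Γ, c 0 = p} =
        closure (((↑) : X → UniformSpace.Completion X) '' A) ∧
      closure {p | ∃ c ∈ Γ, c 1 = p} =
        closure (((↑) : X → UniformSpace.Completion X) '' B) ∧
      ∀ t : unitInterval,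
        closure {p | ∃ c ∈ Γ, c t = p} =
          closure (((↑) : X → UniformSpace.Completion X) '' γ t) ∧
        γ t = ((↑) : X → UniformSpace.Completion X) ⁻¹' closure {p | ∃ c ∈ Γ, c t = p} := by
  have hiso : Isometry ((↑) : X → UniformSpace.Completion X) :=
    UniformSpace.Completion.coe_isometry
  set K : unitInterval → Set (UniformSpace.Completion X) :=
    fun t => closure (((↑) : X → UniformSpace.Completion X) '' γ t) with hKdef
  have hne : ∀ t, (K t).Nonempty := fun t => ((hJ _ (hγJ t)).1.image _).closure
  have hc : ∀ t, IsCompact (K t) := fun t =>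
    TotallyBounded.isCompact_of_isClosed
      ((hJ _ (hγJ t)).2.2.image hiso.uniformContinuous).closure isClosed_closure
  have hK : ∀ s t, ∀ p ∈ K s, ∃ q ∈ K t, dist p q ≤ L * dist s t := by
    intro s t p hp
    obtain ⟨q, hq, hd⟩ := (hc t).exists_infDist_eq_dist (hne t) p
    refine ⟨q, hq, ?_⟩
    rw [← hd]
    refine (Metric.infDist_le_hausdorffDist_of_mem hp
      (Metric.hausdorffEDist_ne_top_of_nonempty_of_bounded (hne s) (hne t)
        (hc s).isBounded (hc t).isBounded)).trans ?_
    rw [hKdef, Metric.hausdorffDist_closure, Metric.hausdorffDist_image hiso]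
    exact hγL s t
  have hsel := selection_aux L K hne hc hK
  let Γ : Set (unitInterval → UniformSpace.Completion X) :=
    {c | (∀ t, c t ∈ K t) ∧ ∀ s t, dist (c s) (c t) ≤ L * dist s t}
  have hΓ : ∀ t, closure {p | ∃ c ∈ Γ, c t = p} = K t := by
    intro t
    have e : {p | ∃ c ∈ Γ, c t = p} = K t := by
      ext p
      constructor
      · rintro ⟨c, hcΓ, rfl⟩
        exact hcΓ.1 t
      · intro hp
        obtain ⟨c, h1, h2, h3⟩ := hsel t p hp
        exact ⟨c, ⟨h1, h3⟩, h2⟩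
    rw [e]
    exact isClosed_closure.closure_eq
  refine ⟨Γ, ?_, fun c hcΓ => hcΓ.2, ?_, ?_, fun t => ⟨hΓ t, ?_⟩⟩
  · obtain ⟨p, hp⟩ := hne 0
    obtain ⟨c, h1, h2, h3⟩ := hsel 0 p hp
    exact ⟨c, h1, h3⟩
  · rw [hΓ 0, ← hγ0]
  · rw [hΓ 1, ← hγ1]
  · rw [hΓ t, hKdef]
    exact (hJ _ (hγJ t)).2.1.closure_eq.symm.trans
      (hiso.isUniformInducing.isInducing.closure_eq_preimage_closure_image (γ t))
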